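/- arXiv:2007.09553 — 2 statements merged into one kernel-verified Lean document; each statement's English description precedes it below -/
import Mathlib

section
/- Let p be an odd prime, n ≥ 2, q = p^n, and 1 ≤ k < n. If β ∈ 𝔽_q satisfies β^{p^{n−k}} ≠ −β and α = −β, then S_{α,β} = 0. -/
open scoped BigOperators Classical

/-- The canonical additive character `χ₁` of a finite field `K` of characteristic `p`:
`χ₁(a) = exp(2πi·Tr(a)/p)` where `Tr` is the absolute trace to `ZMod p`. -/
noncomputable def chi1 (p : ℕ) (K : Type*) [Field K] [Algebra (ZMod p) K] (a : K) : ℂ :=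
  Complex.exp (2 * Real.pi * Complex.I * ((Algebra.trace (ZMod p) K a).val : ℂ) / (p : ℂ))

/-- The Weil sum `S_{α,β} = Σ_{x ∈ K} χ₁(α·x^d + β·(x+1)^d)`. -/
noncomputable def weilS (p : ℕ) (K : Type*) [Field K] [Fintype K] [Algebra (ZMod p) K]
    (d : ℕ) (α β : K) : ℂ :=
  ∑ x : K, chi1 p K (α * x ^ d + β * (x + 1) ^ d)

theorem chi1_eq_stdAddChar (p : ℕ) [Fact p.Prime] (K : Type*) [Field K] [Algebra (ZMod p) K]
    (a : K) : chi1 p K a = ZMod.stdAddChar (Algebra.trace (ZMod p) K a) := by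
  rw [ZMod.stdAddChar_apply, ZMod.toCircle_apply, chi1]

/-- The absolute trace is invariant under every power of the Frobenius map. -/
theorem trace_pow_char_pow (p : ℕ) [Fact p.Prime] (K : Type*) [Field K] [Finite K]
    [Algebra (ZMod p) K] (m : ℕ) (a : K) :
    Algebra.trace (ZMod p) K (a ^ p ^ m) = Algebra.trace (ZMod p) K a := by
  induction m with
  | zero => simp
  | succ m ih =>
    have h := Algebra.trace_eq_of_algEquiv
      (FiniteField.frobeniusAlgEquivOfAlgebraic (ZMod p) K) (a ^ p ^ m)
    rw [← ih, ← h]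
    simp [pow_succ, pow_mul]

/-- Orthogonality: a nontrivial multiplicative shift of the canonical character sums to zero. -/
theorem sum_chi1_mul_eq_zero (p : ℕ) [Fact p.Prime] (K : Type*) [Field K] [Fintype K]
    [Algebra (ZMod p) K] {c : K} (hc : c ≠ 0) : ∑ x : K, chi1 p K (c * x) = 0 := by
  let ψ : AddChar K ℂ := (ZMod.stdAddChar (N := p)).compAddMonoidHom
    ((Algebra.trace (ZMod p) K).toAddMonoidHom.comp (AddMonoidHom.mulLeft c))
  have hψ (x : K) : ψ x = chi1 p K (c * x) := (chi1_eq_stdAddChar p K _).symm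
  have hne : ψ ≠ 1 := fun h ↦ hc <| (traceForm_nondegenerate (ZMod p) K).1 c fun y ↦ by
    apply ZMod.injective_stdAddChar
    rw [Algebra.traceForm_apply, ← chi1_eq_stdAddChar, ← hψ, h, AddChar.map_zero_eq_one,
      AddChar.one_apply]
  simpa only [hψ] using AddChar.sum_eq_zero_of_ne_one hne

theorem weilS_gold_degenerate_zero (p n k : ℕ) [Fact p.Prime] (hp : Odd p) (hn : 2 ≤ n)
    (hk1 : 1 ≤ k) (hkn : k < n)
    (K : Type*) [Field K] [Fintype K] [Algebra (ZMod p) K]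
    (hcard : Fintype.card K = p ^ n)
    (α β : K) (hβ : β ^ (p ^ (n - k)) ≠ -β) (hα : α = -β) :
    weilS p K (p ^ k + 1) α β = 0 := by
  have : CharP K p := charP_of_injective_algebraMap (algebraMap (ZMod p) K).injective p
  have expand (x : K) : α * x ^ (p ^ k + 1) + β * (x + 1) ^ (p ^ k + 1)
      = β * x ^ p ^ k + β * x + β := by
    rw [hα, pow_succ (x + 1), add_pow_char_pow, one_pow]
    ring
  have twist (x : K) : (β * x ^ p ^ k) ^ p ^ (n - k) = β ^ p ^ (n - k) * x := by
    rw [mul_pow, ← pow_mul, ← pow_add, Nat.add_sub_cancel' hkn.le, ← hcard, FiniteField.pow_card]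
  have term (x : K) : chi1 p K (α * x ^ (p ^ k + 1) + β * (x + 1) ^ (p ^ k + 1))
      = chi1 p K ((β ^ p ^ (n - k) + β) * x) * chi1 p K β := by
    rw [expand, chi1_eq_stdAddChar, chi1_eq_stdAddChar, chi1_eq_stdAddChar,
      ← AddChar.map_add_eq_mul, add_mul, LinearMap.map_add, LinearMap.map_add, LinearMap.map_add,
      ← trace_pow_char_pow p K (n - k) (β * x ^ p ^ k), twist]
  rw [weilS, Finset.sum_congr rfl fun x _ ↦ term x, ← Finset.sum_mul,
    sum_chi1_mul_eq_zero p K fun h ↦ hβ (eq_neg_of_add_eq_zero_left h), zero_mul]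
end

section
/- Let p be an odd prime, n ≥ 2, q = p^n, 1 ≤ k < n, e = gcd(n,k) with n/e even, and write n = 2m. Let α, β ∈ 𝔽_q \ {0} with α ≠ −β and β^{p^{n−k}} = −β. Then S_{α,β}² = p^{n+2e}·χ₁(2β) if (α+β)^{(q−1)/(p^e+1)} = (−1)^{m/e}, and S_{α,β}² = p^n·χ₁(2β) otherwise. -/
open scoped BigOperators Classical

section CharacterSums

variable {F : Type*} [Field F] [Fintype F]

/-- The exponential sum of the monomial `a * x ^ (Q + 1)`, multiplied by the one of
`-a * x ^ (Q + 1)`, counts the zeros of the linearized polynomial attached to it. -/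
theorem sum_monomial_mul_sum_neg_monomial (h2 : ringChar F ≠ 2) {Q : ℕ}
    (hadd : ∀ x y : F, (x + y) ^ Q = x ^ Q + y ^ Q)
    (hbij : Function.Bijective fun x : F => x ^ Q)
    {ψ : AddChar F ℂ} (hprim : ψ.IsPrimitive) (hψ : ∀ x, ψ (x ^ Q) = ψ x) (a : F) :
    (∑ x, ψ (a * x ^ (Q + 1))) * ∑ x, ψ (-a * x ^ (Q + 1)) =
      Fintype.card F * Nat.card {x : F // a ^ Q * x ^ (Q * Q) + a * x = 0} := by
  have hbil (x y : F) : ψ (a * (x ^ Q * y + x * y ^ Q)) =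
      ψ (y ^ Q * (a ^ Q * x ^ (Q * Q) + a * x)) := by
    have h : ψ (a * (x ^ Q * y)) = ψ ((a * (x ^ Q * y)) ^ Q) := (hψ _).symm
    rw [mul_add, AddChar.map_add_eq_mul, h, ← AddChar.map_add_eq_mul]
    congr 1
    rw [mul_pow, mul_pow, ← pow_mul]
    ring
  have hsum (x : F) : ∑ y, ψ (y ^ Q * (a ^ Q * x ^ (Q * Q) + a * x)) =
      if a ^ Q * x ^ (Q * Q) + a * x = 0 then (Fintype.card F : ℂ) else 0 := by
    rw [hbij.sum_comp fun z => ψ (z * (a ^ Q * x ^ (Q * Q) + a * x)),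
      AddChar.sum_mulShift _ hprim]
    push_cast
    rfl
  have hone (x : F) (hx : a ^ Q * x ^ (Q * Q) + a * x = 0) : ψ (a * x ^ (Q + 1)) = 1 := by
    have h20 : (2 : F) ≠ 0 := Ring.two_ne_zero h2
    have htwo : ((2 : F)⁻¹) ^ Q = 2⁻¹ := by
      have : (2 : F) ^ Q = 2 := by
        rw [← one_add_one_eq_two, hadd, one_pow]
      rw [inv_pow, this]
    have h := hbil x (x * 2⁻¹)
    rw [hx, mul_zero, AddChar.map_zero_eq_one, mul_pow, htwo] at h
    rw [← h]
    congr 1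
    field_simp
    ring
  calc (∑ x, ψ (a * x ^ (Q + 1))) * ∑ x, ψ (-a * x ^ (Q + 1))
      = ∑ y, ∑ x, ψ (a * x ^ (Q + 1)) * ψ (-a * y ^ (Q + 1)) := by
        rw [Finset.sum_mul_sum, Finset.sum_comm]
    _ = ∑ y, ∑ x, ψ (a * x ^ (Q + 1)) * ψ (y ^ Q * (a ^ Q * x ^ (Q * Q) + a * x)) := by
        refine Finset.sum_congr rfl fun y _ => ?_
        rw [← _root_.Equiv.sum_comp (Equiv.addRight y) fun x =>
          ψ (a * x ^ (Q + 1)) * ψ (-a * y ^ (Q + 1))]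
        refine Finset.sum_congr rfl fun x _ => ?_
        rw [← hbil, ← AddChar.map_add_eq_mul, ← AddChar.map_add_eq_mul, Equiv.coe_addRight,
          pow_succ (x + y), hadd]
        congr 1
        ring
    _ = ∑ x, if a ^ Q * x ^ (Q * Q) + a * x = 0 then (Fintype.card F : ℂ) else 0 := by
        rw [Finset.sum_comm]
        refine Finset.sum_congr rfl fun x _ => ?_
        rw [← Finset.mul_sum, hsum]
        split_ifs with hx
        · rw [hone x hx, one_mul]
        · rw [mul_zero]
    _ = _ := by
        rw [← Finset.sum_filter, Finset.sum_const, Nat.card_eq_fintype_card,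
          Fintype.card_subtype, nsmul_eq_mul, mul_comm]

end CharacterSums

section PowerResidues

theorem IsCyclic.exists_pow_eq_iff {G : Type*} [CommGroup G] [IsCyclic G] [Finite G]
    (N : ℕ) (c : G) :
    (∃ x, x ^ N = c) ↔ c ^ (Nat.card G / (Nat.card G).gcd N) = 1 := by
  have h : (powMonoidHom N : G →* G).range =
      (powMonoidHom (Nat.card G / (Nat.card G).gcd N) : G →* G).ker := by
    refine Subgroup.eq_of_le_of_card_ge ?_ ?_
    · rintro _ ⟨x, rfl⟩
      rw [MonoidHom.mem_ker, powMonoidHom_apply, powMonoidHom_apply, ← pow_mul,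
        ← Nat.mul_div_assoc _ (Nat.gcd_dvd_left _ _), mul_comm,
        Nat.mul_div_assoc _ (Nat.gcd_dvd_right _ _), pow_mul, pow_card_eq_one', one_pow]
    · rw [IsCyclic.card_powMonoidHom_ker, IsCyclic.card_powMonoidHom_range,
        Nat.gcd_eq_right (Nat.div_dvd_of_dvd (Nat.gcd_dvd_left _ _))]
  rw [← powMonoidHom_apply, ← MonoidHom.mem_ker, ← h]
  rfl

theorem card_pow_succ_eq_self (F : Type*) [Field F] [Fintype F] (N : ℕ) :
    Nat.card {x : F // x ^ (N + 1) = x} = (Fintype.card F - 1).gcd N + 1 := by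
  have e : {x : F // x ^ (N + 1) = x} ≃ Option (powMonoidHom N : Fˣ →* Fˣ).ker := by
    refine Equiv.trans ?_ (Equiv.optionCongr
      (Equiv.subtypeEquivRight (p := fun u : Fˣ => (u : F) ^ (N + 1) = u)
        (q := fun u : Fˣ => u ∈ (powMonoidHom N : Fˣ →* Fˣ).ker) fun u => ?_))
    · refine (Equiv.ofBijective (fun o : Option {u : Fˣ // (u : F) ^ (N + 1) = u} =>
        (o.elim ⟨0, by simp⟩ fun u => ⟨(u.1 : F), u.2⟩ : {x : F // x ^ (N + 1) = x}))
        ⟨?_, ?_⟩).symm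
      · rintro (_ | u) (_ | v) h
        · rfl
        · exact absurd (congrArg Subtype.val h).symm v.1.ne_zero
        · exact absurd (congrArg Subtype.val h) u.1.ne_zero
        · simpa [Subtype.ext_iff, Units.ext_iff] using h
      · rintro ⟨x, hx⟩
        rcases eq_or_ne x 0 with rfl | h0
        · exact ⟨none, rfl⟩
        · exact ⟨some ⟨Units.mk0 x h0, hx⟩, rfl⟩
    · rw [MonoidHom.mem_ker, powMonoidHom_apply, Units.ext_iff, pow_succ]
      simp
  rw [Nat.card_congr e, Finite.card_option, IsCyclic.card_powMonoidHom_ker,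
    Nat.card_eq_fintype_card, Fintype.card_units]

theorem neg_one_pow_geom_sum {R : Type*} [CommMonoid R] [HasDistribNeg R] {y : ℕ}
    (hy : Odd y) (t : ℕ) :
    (-1 : R) ^ (∑ i ∈ Finset.range t, y ^ i) = (-1) ^ t := by
  rw [← Finset.prod_pow_eq_pow_sum, Finset.prod_congr rfl fun i _ => hy.pow.neg_one_pow,
    Finset.prod_const, Finset.card_range]

end PowerResidues

section LinearizedKernel

theorem card_linearized_kernel_of_not_exists {F : Type*} [Field F] {Q : ℕ}
    (hQ : 0 < Q) {a : F}
    (h : ¬ ∃ x : F, x ≠ 0 ∧ a ^ Q * x ^ (Q * Q) + a * x = 0) :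
    Nat.card {x : F // a ^ Q * x ^ (Q * Q) + a * x = 0} = 1 := by
  push Not at h
  rw [Nat.card_eq_one_iff_exists]
  refine ⟨⟨0, by simp [hQ.ne']⟩, fun x => Subtype.ext ?_⟩
  by_contra hx
  exact h x.1 hx x.2

variable {F : Type*} [Field F] [Fintype F] {P j t : ℕ}

theorem exists_odd_pow_eq_add_mul (hP : 0 < P) (j : ℕ) :
    ∃ w, P ^ (2 * j + 1) = P + (P ^ 2 - 1) * w := by
  obtain ⟨v, hv⟩ : P ^ 2 - 1 ∣ (P ^ 2) ^ j - 1 := by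
    simpa using Nat.sub_dvd_pow_sub_pow (P ^ 2) 1 j
  refine ⟨v * P, ?_⟩
  have h : (P ^ 2) ^ j = (P ^ 2 - 1) * v + 1 := by
    have := Nat.pow_pos (n := j) (Nat.pow_pos (n := 2) hP)
    omega
  rw [pow_succ, pow_mul, h]
  ring

theorem sq_sub_one_mul_geom_sum (hP : 0 < P) (t : ℕ) :
    (P ^ 2 - 1) * ∑ i ∈ Finset.range t, (P ^ 2) ^ i = (P ^ 2) ^ t - 1 := by
  zify [Nat.one_le_pow 2 P hP, Nat.one_le_pow t (P ^ 2) (Nat.pow_pos hP)]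
  exact mul_geom_sum _ _

theorem sq_pow_sub_one_div_succ (hP : 0 < P) (t : ℕ) :
    ((P ^ 2) ^ t - 1) / (P + 1) = (P - 1) * ∑ i ∈ Finset.range t, (P ^ 2) ^ i := by
  refine Nat.div_eq_of_eq_mul_right P.succ_pos ?_
  rw [← sq_sub_one_mul_geom_sum hP, ← mul_assoc]
  congr 1
  simpa using Nat.sq_sub_sq P 1

theorem exists_pow_odd_pow_succ_eq_neg_one (hP : Odd P)
    (hcard : Fintype.card F = (P ^ 2) ^ t) (j : ℕ) :
    ∃ c : F, c ≠ 0 ∧ c ^ (P ^ (2 * j + 1) + 1) = -1 := by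
  have hc : Nat.card Fˣ = (P ^ 2) ^ t - 1 := by
    rw [Nat.card_eq_fintype_card, Fintype.card_units, hcard]
  have heven : Even (P - 1) := hP.tsub_odd odd_one
  have hsq : P ^ 2 - 1 = (P + 1) * (P - 1) := by simpa using Nat.sq_sub_sq P 1
  have hdvd : P + 1 ∣ (P ^ 2) ^ t - 1 := by
    rw [← sq_sub_one_mul_geom_sum hP.pos, hsq, mul_assoc]
    exact dvd_mul_right _ _
  obtain ⟨c, h⟩ := (IsCyclic.exists_pow_eq_iff (P + 1) (-1 : Fˣ)).2 (by
    rw [hc, Nat.gcd_eq_right hdvd, sq_pow_sub_one_div_succ hP.pos]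
    exact (heven.mul_right _).neg_one_pow)
  obtain ⟨w, hw⟩ := exists_odd_pow_eq_add_mul hP.pos j
  refine ⟨c, c.ne_zero, ?_⟩
  have key : c ^ (P ^ (2 * j + 1) + 1) = -1 := by
    rw [hw, add_right_comm, pow_add, h, pow_mul, hsq, pow_mul, h, heven.neg_one_pow, one_pow,
      mul_one]
  simpa using congrArg Units.val key

theorem gcd_odd_pow_sq_sub_one (hjt : Nat.Coprime (2 * j + 1) t) :
    ((P ^ 2) ^ t - 1).gcd (P ^ (2 * j + 1) * P ^ (2 * j + 1) - 1) = P ^ 2 - 1 := by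
  have : P ^ (2 * j + 1) * P ^ (2 * j + 1) = (P ^ 2) ^ (2 * j + 1) := by ring
  rw [this, Nat.pow_sub_one_gcd_pow_sub_one, hjt.symm.gcd_eq_one, pow_one]

theorem exists_linearized_zero_iff (hP : Odd P) (hP1 : 1 < P)
    (hcard : Fintype.card F = (P ^ 2) ^ t) (hjt : Nat.Coprime (2 * j + 1) t) {a : F}
    (ha : a ≠ 0) :
    (∃ x : F, x ≠ 0 ∧
      a ^ P ^ (2 * j + 1) * x ^ (P ^ (2 * j + 1) * P ^ (2 * j + 1)) + a * x = 0) ↔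
      a ^ (((P ^ 2) ^ t - 1) / (P + 1)) = (-1) ^ t := by
  have hc : Nat.card Fˣ = (P ^ 2) ^ t - 1 := by
    rw [Nat.card_eq_fintype_card, Fintype.card_units, hcard]
  obtain ⟨w, hw⟩ := exists_odd_pow_eq_add_mul hP.pos j
  have hgeom := sq_sub_one_mul_geom_sum hP.pos t
  have hgcd := gcd_odd_pow_sq_sub_one (P := P) hjt
  have hdiv := sq_pow_sub_one_div_succ hP.pos t
  have hodd := neg_one_pow_geom_sum (R := Fˣ) (hP.pow (n := 2)) t
  set R := ∑ i ∈ Finset.range t, (P ^ 2) ^ i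
  have hQpos : 0 < P ^ (2 * j + 1) := Nat.pow_pos hP.pos
  set Q := P ^ (2 * j + 1)
  lift a to Fˣ using ha.isUnit
  have hR : ((P ^ 2) ^ t - 1) / (P ^ 2 - 1) = R := by
    have : 1 < P ^ 2 := Nat.one_lt_pow two_ne_zero hP1
    rw [← hgeom, Nat.mul_div_cancel_left _ (by omega)]
  have hapow : a ^ ((Q - 1) * R) = a ^ ((P - 1) * R) := by
    have : (Q - 1) * R = (P - 1) * R + Nat.card Fˣ * w := by
      rw [hc, ← hgeom, hw, Nat.sub_add_comm hP.pos]
      ring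
    rw [this, pow_add, pow_mul _ (Nat.card Fˣ), pow_card_eq_one', one_pow, mul_one]
  have hunits : (∃ x : F, x ≠ 0 ∧ (a : F) ^ Q * x ^ (Q * Q) + a * x = 0) ↔
      ∃ x : Fˣ, x ^ (Q * Q - 1) = -(a ^ (Q - 1))⁻¹ := by
    have hiff (x : Fˣ) : (a : F) ^ Q * (x : F) ^ (Q * Q) + a * x = 0 ↔
        x ^ (Q * Q - 1) = -(a ^ (Q - 1))⁻¹ := by
      have h1 : (a : F) ^ Q * (x : F) ^ (Q * Q) + a * x =
          a * x * ((a : F) ^ (Q - 1) * (x : F) ^ (Q * Q - 1) + 1) := by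
        have hQ1 : (a : F) ^ Q = a ^ (Q - 1) * a := by
          rw [← pow_succ, Nat.sub_add_cancel hQpos]
        have hQ2 : (x : F) ^ (Q * Q) = x ^ (Q * Q - 1) * x := by
          rw [← pow_succ, Nat.sub_add_cancel (Nat.mul_pos hQpos hQpos)]
        rw [hQ1, hQ2]
        ring
      rw [h1, mul_eq_zero, or_iff_right (mul_ne_zero a.ne_zero x.ne_zero),
        add_eq_zero_iff_eq_neg, Units.ext_iff]
      push_cast
      rw [← neg_one_mul (_⁻¹), ← div_eq_mul_inv, eq_div_iff (pow_ne_zero _ a.ne_zero),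
        mul_comm]
    constructor
    · rintro ⟨x, hx0, hx⟩
      exact ⟨Units.mk0 x hx0, (hiff (Units.mk0 x hx0)).1 hx⟩
    · rintro ⟨x, hx⟩
      exact ⟨x, x.ne_zero, (hiff x).2 hx⟩
  rw [hunits, IsCyclic.exists_pow_eq_iff, hc, hgcd, hR, neg_pow, hodd, inv_pow, ← pow_mul, hapow,
    hdiv, mul_inv_eq_one, eq_comm, Units.ext_iff]
  simp

theorem card_linearized_kernel_of_exists {Q : ℕ} (hQ : 0 < Q) {a : F} (ha : a ≠ 0)
    (h : ∃ x : F, x ≠ 0 ∧ a ^ Q * x ^ (Q * Q) + a * x = 0) :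
    Nat.card {x : F // a ^ Q * x ^ (Q * Q) + a * x = 0} =
      (Fintype.card F - 1).gcd (Q * Q - 1) + 1 := by
  obtain ⟨x, hx0, hx⟩ := h
  have hQQ : Q * Q - 1 + 1 = Q * Q := Nat.sub_add_cancel (Nat.mul_pos hQ hQ)
  rw [← card_pow_succ_eq_self, hQQ]
  refine (Nat.card_congr ((Equiv.mulLeft₀ x hx0).subtypeEquiv fun z => ?_)).symm
  change _ ↔ a ^ Q * (x * z) ^ (Q * Q) + a * (x * z) = 0
  have : a ^ Q * (x * z) ^ (Q * Q) + a * (x * z) = a * x * (z - z ^ (Q * Q)) := by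
    rw [mul_pow]
    linear_combination z ^ (Q * Q) * hx
  simp [this, ha, hx0, sub_eq_zero, eq_comm]

end LinearizedKernel

section Monomial

variable {F : Type*} [Field F] [Fintype F] {P j t : ℕ}

theorem sum_monomial_sq (hP : Odd P) (hP1 : 1 < P)
    (hcard : Fintype.card F = (P ^ 2) ^ t) (hjt : Nat.Coprime (2 * j + 1) t)
    (h2 : ringChar F ≠ 2)
    (hadd : ∀ x y : F, (x + y) ^ P ^ (2 * j + 1) = x ^ P ^ (2 * j + 1) + y ^ P ^ (2 * j + 1))
    (hbij : Function.Bijective fun x : F => x ^ P ^ (2 * j + 1))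
    {ψ : AddChar F ℂ} (hprim : ψ.IsPrimitive) (hψ : ∀ x, ψ (x ^ P ^ (2 * j + 1)) = ψ x)
    {a : F} (ha : a ≠ 0) :
    (∑ x, ψ (a * x ^ (P ^ (2 * j + 1) + 1))) ^ 2 = Fintype.card F *
      if a ^ (((P ^ 2) ^ t - 1) / (P + 1)) = (-1) ^ t then (P : ℂ) ^ 2 else 1 := by
  have hQ : 0 < P ^ (2 * j + 1) := Nat.pow_pos hP.pos
  obtain ⟨c, hc0, hc⟩ := exists_pow_odd_pow_succ_eq_neg_one hP hcard j
  have hneg : ∑ x, ψ (a * x ^ (P ^ (2 * j + 1) + 1)) =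
      ∑ x, ψ (-a * x ^ (P ^ (2 * j + 1) + 1)) := by
    rw [← _root_.Equiv.sum_comp (Equiv.mulLeft₀ c hc0) fun x =>
      ψ (a * x ^ (P ^ (2 * j + 1) + 1))]
    refine Finset.sum_congr rfl fun x _ => ?_
    change ψ (a * (c * x) ^ (P ^ (2 * j + 1) + 1)) = _
    rw [mul_pow, hc]
    congr 1
    ring
  rw [sq]
  nth_rw 2 [hneg]
  rw [sum_monomial_mul_sum_neg_monomial h2 hadd hbij hprim hψ]
  congr 1
  split_ifs with h <;> rw [← exists_linearized_zero_iff hP hP1 hcard hjt ha] at h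
  · rw [card_linearized_kernel_of_exists hQ ha h, hcard, gcd_odd_pow_sq_sub_one hjt,
      Nat.sub_add_cancel (Nat.pow_pos hP.pos), Nat.cast_pow]
  · rw [card_linearized_kernel_of_not_exists hQ h, Nat.cast_one]

end Monomial

section CanonicalCharacter

variable (p : ℕ) [Fact p.Prime] (K : Type*) [Field K] [Algebra (ZMod p) K]

/-- The canonical additive character `chi1` as a bundled `AddChar`. -/
noncomputable def chi1AddChar : AddChar K ℂ :=
  (ZMod.stdAddChar (N := p)).compAddMonoidHom (Algebra.trace (ZMod p) K).toAddMonoidHom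

theorem chi1_eq_chi1AddChar (a : K) : chi1 p K a = chi1AddChar p K a :=
  (ZMod.toCircle_apply (Algebra.trace (ZMod p) K a)).symm

variable [Fintype K]

theorem isPrimitive_chi1AddChar : (chi1AddChar p K).IsPrimitive := by
  refine AddChar.IsPrimitive.of_ne_one fun h => ?_
  obtain ⟨x, hx⟩ := Algebra.trace_surjective (ZMod p) K 1
  have hx1 : ZMod.stdAddChar (Algebra.trace (ZMod p) K x) = 1 := DFunLike.congr_fun h x
  rw [hx, ← (ZMod.stdAddChar (N := p)).map_zero_eq_one, ZMod.injective_stdAddChar.eq_iff] at hx1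
  exact one_ne_zero hx1

theorem chi1AddChar_pow_prime_pow (i : ℕ) (x : K) :
    chi1AddChar p K (x ^ p ^ i) = chi1AddChar p K x := by
  induction i with
  | zero => simp
  | succ i ih =>
    rw [pow_succ, pow_mul, ← ih]
    have h := Algebra.trace_eq_of_algEquiv
      (FiniteField.frobeniusAlgEquivOfAlgebraic (ZMod p) K) (x ^ p ^ i)
    rw [FiniteField.coe_frobeniusAlgEquivOfAlgebraic, ZMod.card] at h
    exact congrArg ZMod.stdAddChar h

/-- When `β ^ (p ^ (n - k)) = -β`, the linear part of the Weil sum has trace zero. -/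
theorem weilS_eq_mul_sum_monomial {n k : ℕ} (hkn : k ≤ n) (hcard : Fintype.card K = p ^ n)
    {α β : K} (hβ : β ^ p ^ (n - k) = -β) :
    weilS p K (p ^ k + 1) α β =
      chi1AddChar p K β * ∑ x, chi1AddChar p K ((α + β) * x ^ (p ^ k + 1)) := by
  have : CharP K p := charP_of_injective_algebraMap (algebraMap (ZMod p) K).injective p
  have hβk : β ^ p ^ k = -β := by
    have h : (β ^ p ^ (n - k)) ^ p ^ k = β := by
      rw [← pow_mul, ← pow_add, Nat.sub_add_cancel hkn, ← hcard, FiniteField.pow_card]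
    rw [hβ, ← iterateFrobenius_def, map_neg, iterateFrobenius_def] at h
    rw [← h, neg_neg, h]
  have hlin (x : K) : chi1AddChar p K (β * x ^ p ^ k + β * x) = 1 := by
    rw [AddChar.map_add_eq_mul, ← chi1AddChar_pow_prime_pow p K k (β * x), mul_pow, hβk,
      ← AddChar.map_add_eq_mul, neg_mul, add_neg_cancel, AddChar.map_zero_eq_one]
  rw [weilS, Finset.mul_sum]
  refine Finset.sum_congr rfl fun x _ => ?_
  rw [chi1_eq_chi1AddChar, ← AddChar.map_add_eq_mul,
    ← mul_one (chi1AddChar p K (β + _)), ← hlin x, ← AddChar.map_add_eq_mul,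
    pow_succ (x + 1), add_pow_char_pow, one_pow]
  congr 1
  ring

end CanonicalCharacter

theorem weilS_sq_semi_degenerate (p n k e m : ℕ) [Fact p.Prime] (hp : Odd p) (hn : 2 ≤ n)
    (hk1 : 1 ≤ k) (hkn : k < n) (he : e = Nat.gcd n k) (heven : Even (n / e))
    (hm : n = 2 * m)
    (K : Type*) [Field K] [Fintype K] [Algebra (ZMod p) K]
    (hcard : Fintype.card K = p ^ n)
    (α β : K) (hα0 : α ≠ 0) (hβ0 : β ≠ 0) (hαβ : α ≠ -β) (hβ : β ^ (p ^ (n - k)) = -β) :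
    ((α + β) ^ ((p ^ n - 1) / (p ^ e + 1)) = (-1 : K) ^ (m / e) →
        weilS p K (p ^ k + 1) α β ^ 2 = (p : ℂ) ^ (n + 2 * e) * chi1 p K (2 * β)) ∧
      ((α + β) ^ ((p ^ n - 1) / (p ^ e + 1)) ≠ (-1 : K) ^ (m / e) →
        weilS p K (p ^ k + 1) α β ^ 2 = (p : ℂ) ^ n * chi1 p K (2 * β)) := by
  have hp1 : 1 < p := (Fact.out : p.Prime).one_lt
  have : CharP K p := charP_of_injective_algebraMap (algebraMap (ZMod p) K).injective p
  have h2 : ringChar K ≠ 2 := by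
    rw [ringChar.eq K p]
    rintro rfl
    exact absurd hp (by decide)
  have he0 : 0 < e := he ▸ Nat.gcd_pos_of_pos_left k (by omega)
  obtain ⟨t, ht⟩ : ∃ t, n = e * (2 * t) := by
    obtain ⟨t, ht⟩ := heven
    exact ⟨t, by rw [two_mul, ← ht, Nat.mul_div_cancel' (he ▸ Nat.gcd_dvd_left n k)]⟩
  have hmt : m / e = t := by
    rw [show m = e * t by linarith, Nat.mul_div_cancel_left _ he0]
  have hcop : Nat.Coprime (2 * t) (k / e) := by
    have h := Nat.coprime_div_gcd_div_gcd (he ▸ he0 : 0 < n.gcd k)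
    rwa [← he, show n / e = 2 * t by rw [ht, Nat.mul_div_cancel_left _ he0]] at h
  obtain ⟨j, hj⟩ : Odd (k / e) := Nat.coprime_two_left.1 (hcop.coprime_mul_right)
  rw [hj] at hcop
  have hk : k = e * (2 * j + 1) := by
    rw [← hj, Nat.mul_div_cancel' (he ▸ Nat.gcd_dvd_right n k)]
  have hpn : p ^ n = ((p ^ e) ^ 2) ^ t := by
    rw [← pow_mul, ← pow_mul, ht]
  have hpk : p ^ k = (p ^ e) ^ (2 * j + 1) := by rw [← pow_mul, ← hk]
  have hsq := sum_monomial_sq (F := K) (P := p ^ e) (j := j) (t := t) (hp.pow)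
    (Nat.one_lt_pow he0.ne' hp1) (hcard.trans hpn) (hcop.coprime_mul_left).symm h2
    (by simpa only [← hpk] using fun x y : K => add_pow_char_pow x y p k)
    (by
      rw [← hpk]
      exact Finite.injective_iff_bijective.1 (iterateFrobenius_inj K p k))
    (isPrimitive_chi1AddChar p K)
    (by simpa only [← hpk] using chi1AddChar_pow_prime_pow p K k)
    (a := α + β) (fun h => hαβ (eq_neg_of_add_eq_zero_left h))
  rw [← hpk, ← hpn, hcard] at hsq
  have hS : weilS p K (p ^ k + 1) α β ^ 2 = chi1 p K (2 * β) *
      (∑ x, chi1AddChar p K ((α + β) * x ^ (p ^ k + 1))) ^ 2 := by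
    rw [weilS_eq_mul_sum_monomial p K hkn.le hcard hβ, mul_pow, chi1_eq_chi1AddChar, two_mul,
      AddChar.map_add_eq_mul, sq (chi1AddChar p K β)]
  rw [hS, hsq, hmt]
  constructor <;> intro h
  · rw [if_pos h]
    push_cast
    ring
  · rw [if_neg h]
    push_cast
    ring
end
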